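/- arXiv:2603.08543 — 11 statements merged into one kernel-verified Lean document; each statement's English description precedes it below -/
import Mathlib

section
/- Let 𝔠 ∈ ℂ∖{0}, let φ, ψ ∈ ℂ[x], and let u be a linear functional on ℂ[x] satisfying u(φ·D_𝔠 p + ψ·S_𝔠 p) = 0 for every polynomial p. Fix β ∈ ℂ∖{0} and α ∈ ℂ, and define the linear functional v on ℂ[x] by v(p) = u(p(βx + α)) (substitution x ↦ βx + α inside p), together with the polynomials φ′(x) = β·φ((x − α)/β) and ψ′(x) = ψ((x − α)/β). Then v(φ′·D_{β𝔠} q + ψ′·S_{β𝔠} q) = 0 for every polynomial q. -/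
open Polynomial

/-- The step-`c` operator `(D_c p)(x) = (p(x + c/2) − p(x − c/2))/c`. -/
noncomputable def Dc (c : ℂ) (p : ℂ[X]) : ℂ[X] :=
  c⁻¹ • (p.comp (X + C (c / 2)) - p.comp (X - C (c / 2)))

/-- The step-`c` operator `(S_c p)(x) = (p(x + c/2) + p(x − c/2))/2`. -/
noncomputable def Sc (c : ℂ) (p : ℂ[X]) : ℂ[X] :=
  (2 : ℂ)⁻¹ • (p.comp (X + C (c / 2)) + p.comp (X - C (c / 2)))

theorem comp_add_comp_affine (q : ℂ[X]) (β α d : ℂ) :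
    (q.comp (X + C (β * d))).comp (C β * X + C α) =
      (q.comp (C β * X + C α)).comp (X + C d) := by
  simp only [comp_assoc]
  congr 1
  simp only [add_comp, mul_comp, X_comp, C_comp, C_mul]
  ring

theorem comp_sub_comp_affine (q : ℂ[X]) (β α d : ℂ) :
    (q.comp (X - C (β * d))).comp (C β * X + C α) =
      (q.comp (C β * X + C α)).comp (X - C d) := by
  simpa [sub_eq_add_neg] using comp_add_comp_affine q β α (-d)

theorem Dc_comp_affine (c β α : ℂ) (q : ℂ[X]) :
    (Dc (β * c) q).comp (C β * X + C α) = C β⁻¹ * Dc c (q.comp (C β * X + C α)) := by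
  rw [← smul_eq_C_mul β⁻¹]
  simp only [Dc, smul_comp, sub_comp, mul_div_assoc, comp_add_comp_affine,
    comp_sub_comp_affine, mul_inv, mul_smul]

theorem Sc_comp_affine (c β α : ℂ) (q : ℂ[X]) :
    (Sc (β * c) q).comp (C β * X + C α) = Sc c (q.comp (C β * X + C α)) := by
  simp only [Sc, smul_comp, add_comp, mul_div_assoc, comp_add_comp_affine,
    comp_sub_comp_affine]

theorem comp_affine_inv_comp_affine (p : ℂ[X]) {β : ℂ} (hβ : β ≠ 0) (α : ℂ) :
    (p.comp (C β⁻¹ * (X - C α))).comp (C β * X + C α) = p := by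
  rw [comp_assoc]
  simp only [mul_comp, sub_comp, X_comp, C_comp, add_sub_cancel_right]
  rw [← mul_assoc, ← C_mul, inv_mul_cancel₀ hβ, C_1, one_mul, comp_X]

/-- Affine invariance of the lattice Pearson equation: if `u` satisfies
`D_𝔠(φu) = S_𝔠(ψu)` (i.e. `u(φ·D_𝔠 p + ψ·S_𝔠 p) = 0` for all `p`), `β ≠ 0`,
`v(p) = u(p(βx + α))`, `φ'(x) = β·φ((x − α)/β)` and `ψ'(x) = ψ((x − α)/β)`, then
`v(φ'·D_{β𝔠} q + ψ'·S_{β𝔠} q) = 0` for all `q`. -/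
theorem pearson_affine_invariance (𝔠 : ℂ) (h𝔠 : 𝔠 ≠ 0) (φ ψ : ℂ[X])
    (u : ℂ[X] →ₗ[ℂ] ℂ)
    (hu : ∀ p : ℂ[X], u (φ * Dc 𝔠 p + ψ * Sc 𝔠 p) = 0)
    (β : ℂ) (hβ : β ≠ 0) (α : ℂ)
    (v : ℂ[X] →ₗ[ℂ] ℂ)
    (hv : ∀ p : ℂ[X], v p = u (p.comp (C β * X + C α)))
    (φ' ψ' : ℂ[X])
    (hφ' : φ' = C β * φ.comp (C β⁻¹ * (X - C α)))
    (hψ' : ψ' = ψ.comp (C β⁻¹ * (X - C α))) :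
    ∀ q : ℂ[X], v (φ' * Dc (β * 𝔠) q + ψ' * Sc (β * 𝔠) q) = 0 := by
  intro q
  rw [hv, ← hu (q.comp (C β * X + C α)), hφ', hψ']
  simp only [add_comp, mul_comp, C_comp, Dc_comp_affine, Sc_comp_affine,
    comp_affine_inv_comp_affine _ hβ]
  rw [mul_mul_mul_comm, ← C_mul, mul_inv_cancel₀ hβ, C_1, one_mul]
end

section
/- Let φ, ψ ∈ ℂ[x] and let u be a linear functional on ℂ[x]. (a) If u(φ·∇q + ψ·q) = 0 for every polynomial q (the functional form of Δ(φu) = ψu), then u((2φ + ψ)·D₁q + 2ψ·S₁q) = 0 for every polynomial q, where D₁, S₁ are the step-1 operators. (b) Conversely, if u(φ·D₁q + ψ·S₁q) = 0 for every polynomial q, then u((2φ − ψ)·∇q + 2ψ·q) = 0 for every polynomial q. -/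
open Polynomial

/-- The backward difference operator `(∇p)(x) = p(x) − p(x−1)`. -/
noncomputable def nabla (p : ℂ[X]) : ℂ[X] := p - p.comp (X - C 1)

/-- The centered difference is the backward difference of the half-step forward shift. -/
lemma Dc_one_eq_nabla (q : ℂ[X]) : Dc 1 q = nabla (q.comp (X + C (1 / 2))) := by
  have h : (X - C 1 + C (1 / 2) : ℂ[X]) = X - C (1 / 2) := by
    rw [sub_add, ← C_sub]; norm_num
  simp [Dc, nabla, comp_assoc, add_comp, ← h, -map_one, -one_div]

/-- The centered mean, corrected by half the centered difference, is the half-step forward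
shift. -/
lemma Dc_one_add_two_mul_Sc_one (q : ℂ[X]) :
    Dc 1 q + 2 * Sc 1 q = 2 * q.comp (X + C (1 / 2)) := by
  have h : (2 : ℂ[X]) = C 2 := rfl
  have h2 : (C 2 * C 2⁻¹ : ℂ[X]) = 1 := by rw [← C_mul]; norm_num
  simp only [Dc, Sc, smul_eq_C_mul, h, inv_one, C_1, one_mul, ← mul_assoc, h2]
  rw [← h]; ring

/-- The half-step backward shift is a right inverse of the half-step forward shift. -/
lemma comp_sub_half_comp_add_half (q : ℂ[X]) :
    (q.comp (X - C (1 / 2))).comp (X + C (1 / 2)) = q := by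
  simp [comp_assoc]

/-- (a) If `u(φ·∇q + ψ·q) = 0` for all `q` (i.e. `Δ(φu) = ψu`), then
`u((2φ + ψ)·D₁q + 2ψ·S₁q) = 0` for all `q`.
(b) Conversely, if `u(φ·D₁q + ψ·S₁q) = 0` for all `q`, then
`u((2φ − ψ)·∇q + 2ψ·q) = 0` for all `q`. -/
theorem forward_difference_to_centered (φ ψ : ℂ[X]) (u : ℂ[X] →ₗ[ℂ] ℂ) :
    ((∀ q : ℂ[X], u (φ * nabla q + ψ * q) = 0) →
      ∀ q : ℂ[X], u ((2 * φ + ψ) * Dc 1 q + (2 * ψ) * Sc 1 q) = 0) ∧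
    ((∀ q : ℂ[X], u (φ * Dc 1 q + ψ * Sc 1 q) = 0) →
      ∀ q : ℂ[X], u ((2 * φ - ψ) * nabla q + (2 * ψ) * q) = 0) := by
  refine ⟨fun h q => ?_, fun h q => ?_⟩
  · have key : (2 * φ + ψ) * Dc 1 q + (2 * ψ) * Sc 1 q =
        (2 : ℂ) • (φ * nabla (q.comp (X + C (1 / 2))) + ψ * q.comp (X + C (1 / 2))) := by
      rw [ofNat_smul_eq_nsmul, two_nsmul, ← Dc_one_eq_nabla]
      linear_combination ψ * Dc_one_add_two_mul_Sc_one q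
    rw [key, map_smul, h, smul_zero]
  · have hD := Dc_one_eq_nabla (q.comp (X - C (1 / 2)))
    have hS := Dc_one_add_two_mul_Sc_one (q.comp (X - C (1 / 2)))
    rw [comp_sub_half_comp_add_half] at hD hS
    have key : (2 * φ - ψ) * nabla q + (2 * ψ) * q =
        (2 : ℂ) • (φ * Dc 1 (q.comp (X - C (1 / 2))) + ψ * Sc 1 (q.comp (X - C (1 / 2)))) := by
      rw [ofNat_smul_eq_nsmul, two_nsmul, ← hD]
      linear_combination -ψ * hS
    rw [key, map_smul, h, smul_zero]
end

section
/- Let φ, ψ ∈ ℂ[x] and let u be a linear functional on ℂ[x]. (a) If u(φ·Δq + ψ·q) = 0 for every polynomial q (the functional form of ∇(φu) = ψu), then u((2φ − ψ)·D₁q + 2ψ·S₁q) = 0 for every polynomial q, where D₁, S₁ are the step-1 operators. (b) Conversely, if u(φ·D₁q + ψ·S₁q) = 0 for every polynomial q, then u((2φ + ψ)·Δq + 2ψ·q) = 0 for every polynomial q. -/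
open Polynomial

/-- The forward difference operator `(Δp)(x) = p(x+1) − p(x)`. -/
noncomputable def fdelta (p : ℂ[X]) : ℂ[X] := p.comp (X + C 1) - p

theorem Dc_one_eq_fdelta (q : ℂ[X]) : Dc 1 q = fdelta (q.comp (X - C (1 / 2))) := by
  have h : (X + C 1 - C (1 / 2) : ℂ[X]) = X + C (1 / 2) := by
    rw [add_sub_assoc, ← C_sub]; norm_num
  simp only [Dc, fdelta, comp_assoc, sub_comp, X_comp, C_comp, h, inv_one, one_smul]

theorem two_mul_Sc_one (q : ℂ[X]) :
    2 * Sc 1 q = 2 * q.comp (X - C (1 / 2)) + fdelta (q.comp (X - C (1 / 2))) := by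
  have h : (X + C 1 - C (1 / 2) : ℂ[X]) = X + C (1 / 2) := by
    rw [add_sub_assoc, ← C_sub]; norm_num
  have h2 (p : ℂ[X]) : 2 * ((2 : ℂ)⁻¹ • p) = p := by
    rw [← C_ofNat, ← smul_eq_C_mul, smul_smul]; norm_num
  simp only [Sc, h2, fdelta, comp_assoc, sub_comp, X_comp, C_comp, h]
  ring

theorem comp_X_add_C_comp_X_sub_C (q : ℂ[X]) (a : ℂ) :
    (q.comp (X + C a)).comp (X - C a) = q := by
  simp [comp_assoc]

/-- (a) If `u(φ·Δq + ψ·q) = 0` for all `q` (i.e. `∇(φu) = ψu`), then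
`u((2φ − ψ)·D₁q + 2ψ·S₁q) = 0` for all `q`.
(b) Conversely, if `u(φ·D₁q + ψ·S₁q) = 0` for all `q`, then
`u((2φ + ψ)·Δq + 2ψ·q) = 0` for all `q`. -/
theorem backward_difference_to_centered (φ ψ : ℂ[X]) (u : ℂ[X] →ₗ[ℂ] ℂ) :
    ((∀ q : ℂ[X], u (φ * fdelta q + ψ * q) = 0) →
      ∀ q : ℂ[X], u ((2 * φ - ψ) * Dc 1 q + (2 * ψ) * Sc 1 q) = 0) ∧
    ((∀ q : ℂ[X], u (φ * Dc 1 q + ψ * Sc 1 q) = 0) →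
      ∀ q : ℂ[X], u ((2 * φ + ψ) * fdelta q + (2 * ψ) * q) = 0) := by
  refine ⟨fun h q => ?_, fun h q => ?_⟩
  · set p := q.comp (X - C (1 / 2)) with hp
    have e : (2 * φ - ψ) * Dc 1 q + (2 * ψ) * Sc 1 q =
        (φ * fdelta p + ψ * p) + (φ * fdelta p + ψ * p) := by
      rw [Dc_one_eq_fdelta, ← hp]
      linear_combination ψ * two_mul_Sc_one q
    rw [e, map_add, h, add_zero]
  · set r := q.comp (X + C (1 / 2)) with hr
    have hD := Dc_one_eq_fdelta r
    have hS := two_mul_Sc_one r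
    rw [hr, comp_X_add_C_comp_X_sub_C, ← hr] at hD hS
    have e : (2 * φ + ψ) * fdelta q + (2 * ψ) * q =
        (φ * Dc 1 r + ψ * Sc 1 r) + (φ * Dc 1 r + ψ * Sc 1 r) := by
      linear_combination -2 * φ * hD - ψ * hS
    rw [e, map_add, h, add_zero]
end

section
/- (1-Laguerre reduction.) Let 𝔠 ∈ ℂ∖{0}, let b, c, d, e ∈ ℂ with b ≠ 0, and let u be a linear functional on ℂ[x] satisfying u((bx + c)·D_𝔠 p + (dx + e)·S_𝔠 p) = 0 for every polynomial p. Define the linear functional v on ℂ[x] by v(p) = u(p(𝔠^{−1}x + c/(b𝔠))) (substitution x ↦ x/𝔠 + c/(b𝔠) inside p), and set α = (d/b)·𝔠 and β = (be − dc)/b². Then v(x·D₁q + (α x + β)·S₁q) = 0 for every polynomial q, where D₁, S₁ are the step-1 operators. -/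
open Polynomial

theorem Sc_comp_linear (s t : ℂ) (hs : s ≠ 0) (q : ℂ[X]) :
    (Sc 1 q).comp (C s⁻¹ * X + C t) = Sc s (q.comp (C s⁻¹ * X + C t)) := by
  refine Polynomial.funext fun x => ?_
  simp only [Sc, eval_comp, eval_smul, eval_add, eval_sub, eval_mul, eval_C, eval_X, smul_eq_mul]
  congr 3 <;> field_simp <;> ring

theorem Dc_comp_linear (s t : ℂ) (hs : s ≠ 0) (q : ℂ[X]) :
    (Dc 1 q).comp (C s⁻¹ * X + C t) = s • Dc s (q.comp (C s⁻¹ * X + C t)) := by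
  refine Polynomial.funext fun x => ?_
  simp only [Dc, eval_comp, eval_smul, eval_add, eval_sub, eval_mul, eval_C, eval_X, smul_eq_mul,
    inv_one, one_mul, mul_inv_cancel_left₀ hs]
  congr 2 <;> field_simp <;> ring

/-- **1-Laguerre reduction.** If `u` satisfies the lattice Pearson equation with
`φ(x) = bx + c` (`b ≠ 0`) and `ψ(x) = dx + e` on the step-`𝔠` lattice, then the
functional `v(p) = u(p(x/𝔠 + c/(b𝔠)))` satisfies the step-1 Pearson equation with
`Φ(x) = x` and `Ψ(x) = αx + β`, where `α = (d/b)·𝔠` and `β = (be − dc)/b²`. -/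
theorem one_laguerre_reduction (𝔠 : ℂ) (h𝔠 : 𝔠 ≠ 0) (b c d e : ℂ) (hb : b ≠ 0)
    (u : ℂ[X] →ₗ[ℂ] ℂ)
    (hu : ∀ p : ℂ[X], u ((C b * X + C c) * Dc 𝔠 p + (C d * X + C e) * Sc 𝔠 p) = 0)
    (v : ℂ[X] →ₗ[ℂ] ℂ)
    (hv : ∀ p : ℂ[X], v p = u (p.comp (C 𝔠⁻¹ * X + C (c / (b * 𝔠)))))
    (α β : ℂ) (hα : α = (d / b) * 𝔠) (hβ : β = (b * e - d * c) / b ^ 2) :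
    ∀ q : ℂ[X], v (X * Dc 1 q + (C α * X + C β) * Sc 1 q) = 0 := by
  intro q
  have key : (X * Dc 1 q + (C α * X + C β) * Sc 1 q).comp (C 𝔠⁻¹ * X + C (c / (b * 𝔠))) =
      b⁻¹ • ((C b * X + C c) * Dc 𝔠 (q.comp (C 𝔠⁻¹ * X + C (c / (b * 𝔠)))) +
        (C d * X + C e) * Sc 𝔠 (q.comp (C 𝔠⁻¹ * X + C (c / (b * 𝔠))))) := by
    rw [add_comp, mul_comp, mul_comp, Sc_comp_linear _ _ h𝔠, Dc_comp_linear _ _ h𝔠]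
    refine Polynomial.funext fun x => ?_
    simp only [add_comp, mul_comp, X_comp, C_comp, eval_smul, eval_add, eval_mul, eval_C, eval_X,
      smul_eq_mul, hα, hβ]
    field_simp
    ring
  rw [hv, key, map_smul, hu, smul_zero]
end

section
/- (1-Bessel reduction.) Let 𝔠 ∈ ℂ∖{0}, let a, b, c, d, e ∈ ℂ with a ≠ 0 and b² − 4ac = 0, and let u be a linear functional on ℂ[x] satisfying u((ax² + bx + c)·D_𝔠 p + (dx + e)·S_𝔠 p) = 0 for every polynomial p. Define the linear functional v on ℂ[x] by v(p) = u(p(𝔠^{−1}x + b/(2a𝔠))) (substitution x ↦ x/𝔠 + b/(2a𝔠) inside p), and set α = d/a and β = (2ae − bd)/(2a²𝔠). Then v(x²·D₁q + (α x + β)·S₁q) = 0 for every polynomial q, where D₁, S₁ are the step-1 operators. -/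
open Polynomial

/-- **1-Bessel reduction.** If `u` satisfies the lattice Pearson equation with
`φ(x) = ax² + bx + c` (`a ≠ 0`, `b² − 4ac = 0`) and `ψ(x) = dx + e` on the step-`𝔠`
lattice, then the functional `v(p) = u(p(x/𝔠 + b/(2a𝔠)))` satisfies the step-1
Pearson equation with `Φ(x) = x²` and `Ψ(x) = αx + β`, where `α = d/a` and
`β = (2ae − bd)/(2a²𝔠)`. -/
theorem one_bessel_reduction (𝔠 : ℂ) (h𝔠 : 𝔠 ≠ 0) (a b c d e : ℂ) (ha : a ≠ 0)
    (hdisc : b ^ 2 - 4 * a * c = 0) (u : ℂ[X] →ₗ[ℂ] ℂ)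
    (hu : ∀ p : ℂ[X],
      u ((C a * X ^ 2 + C b * X + C c) * Dc 𝔠 p + (C d * X + C e) * Sc 𝔠 p) = 0)
    (v : ℂ[X] →ₗ[ℂ] ℂ)
    (hv : ∀ p : ℂ[X], v p = u (p.comp (C 𝔠⁻¹ * X + C (b / (2 * a * 𝔠)))))
    (α β : ℂ) (hα : α = d / a) (hβ : β = (2 * a * e - b * d) / (2 * a ^ 2 * 𝔠)) :
    ∀ q : ℂ[X], v (X ^ 2 * Dc 1 q + (C α * X + C β) * Sc 1 q) = 0 := by
  intro q
  have shift : ∀ x t : ℂ, 𝔠⁻¹ * (x + 𝔠 * t) + b / (2 * a * 𝔠) =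
      𝔠⁻¹ * x + b / (2 * a * 𝔠) + t := by
    intro x t
    field_simp
    ring
  have key : (X ^ 2 * Dc 1 q + (C α * X + C β) * Sc 1 q).comp
        (C 𝔠⁻¹ * X + C (b / (2 * a * 𝔠))) =
      (a * 𝔠)⁻¹ • ((C a * X ^ 2 + C b * X + C c) *
          Dc 𝔠 (q.comp (C 𝔠⁻¹ * X + C (b / (2 * a * 𝔠)))) +
        (C d * X + C e) * Sc 𝔠 (q.comp (C 𝔠⁻¹ * X + C (b / (2 * a * 𝔠))))) := by
    refine Polynomial.funext fun x => ?_
    have hp := shift x (1 / 2)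
    have hm := shift x (-(1 / 2))
    rw [show x + 𝔠 * (1 / 2) = x + 𝔠 / 2 by ring] at hp
    rw [show x + 𝔠 * -(1 / 2) = x - 𝔠 / 2 by ring, ← sub_eq_add_neg] at hm
    simp only [Dc, Sc, eval_comp, eval_add, eval_mul, eval_sub, eval_pow, eval_X, eval_C,
      eval_smul, smul_eq_mul, hp, hm]
    have hc : c = b ^ 2 / (4 * a) := by
      field_simp
      linear_combination -hdisc
    rw [hα, hβ, hc]
    generalize eval (𝔠⁻¹ * x + b / (2 * a * 𝔠) + 1 / 2) q = A
    generalize eval (𝔠⁻¹ * x + b / (2 * a * 𝔠) - 1 / 2) q = B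
    field_simp
    ring
  rw [hv, key, map_smul, hu, smul_zero]
end

section
/- (1-Jacobi reduction.) Let 𝔠 ∈ ℂ∖{0}, let a, b, c, d, e ∈ ℂ with a ≠ 0 and b² − 4ac ≠ 0, and let u be a linear functional on ℂ[x] satisfying u((ax² + bx + c)·D_𝔠 p + (dx + e)·S_𝔠 p) = 0 for every polynomial p. Define the linear functional v on ℂ[x] by v(p) = u(p(𝔠^{−1}x + b/(2a𝔠))) (substitution x ↦ x/𝔠 + b/(2a𝔠) inside p), and set α = d/a, β = (2ae − bd)/(2a²𝔠), and γ = (b² − 4ac)/(4a²𝔠²). Then v((x² − γ)·D₁q + (α x + β)·S₁q) = 0 for every polynomial q, where D₁, S₁ are the step-1 operators. -/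
open Polynomial

/-- An affine substitution of slope `c⁻¹` intertwines the step-`1` and step-`c` differences. -/
lemma Dc_one_comp_affine {c : ℂ} (hc : c ≠ 0) (t : ℂ) (q : ℂ[X]) :
    (Dc 1 q).comp (C c⁻¹ * X + C t) = C c * Dc c (q.comp (C c⁻¹ * X + C t)) := by
  refine Polynomial.funext fun x => ?_
  have hplus : c⁻¹ * (x + c / 2) + t = c⁻¹ * x + t + 1 / 2 := by field_simp; ring
  have hminus : c⁻¹ * (x - c / 2) + t = c⁻¹ * x + t - 1 / 2 := by field_simp; ring
  simp only [Dc, eval_comp, eval_mul, eval_smul, eval_sub, eval_add, eval_C, eval_X,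
    smul_eq_mul, hplus, hminus]
  field_simp

/-- An affine substitution of slope `c⁻¹` intertwines the step-`1` and step-`c` averages. -/
lemma Sc_one_comp_affine {c : ℂ} (hc : c ≠ 0) (t : ℂ) (q : ℂ[X]) :
    (Sc 1 q).comp (C c⁻¹ * X + C t) = Sc c (q.comp (C c⁻¹ * X + C t)) := by
  refine Polynomial.funext fun x => ?_
  have hplus : c⁻¹ * (x + c / 2) + t = c⁻¹ * x + t + 1 / 2 := by field_simp; ring
  have hminus : c⁻¹ * (x - c / 2) + t = c⁻¹ * x + t - 1 / 2 := by field_simp; ring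
  simp only [Sc, eval_comp, eval_smul, eval_sub, eval_add, eval_mul, eval_C, eval_X,
    smul_eq_mul, hplus, hminus]

/-- **1-Jacobi reduction.** If `u` satisfies the lattice Pearson equation with
`φ(x) = ax² + bx + c` (`a ≠ 0`, `b² − 4ac ≠ 0`) and `ψ(x) = dx + e` on the step-`𝔠`
lattice, then the functional `v(p) = u(p(x/𝔠 + b/(2a𝔠)))` satisfies the step-1
Pearson equation with `Φ(x) = x² − γ` and `Ψ(x) = αx + β`, where `α = d/a`,
`β = (2ae − bd)/(2a²𝔠)` and `γ = (b² − 4ac)/(4a²𝔠²)`. -/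
theorem one_jacobi_reduction (𝔠 : ℂ) (h𝔠 : 𝔠 ≠ 0) (a b c d e : ℂ) (ha : a ≠ 0)
    (hdisc : b ^ 2 - 4 * a * c ≠ 0) (u : ℂ[X] →ₗ[ℂ] ℂ)
    (hu : ∀ p : ℂ[X],
      u ((C a * X ^ 2 + C b * X + C c) * Dc 𝔠 p + (C d * X + C e) * Sc 𝔠 p) = 0)
    (v : ℂ[X] →ₗ[ℂ] ℂ)
    (hv : ∀ p : ℂ[X], v p = u (p.comp (C 𝔠⁻¹ * X + C (b / (2 * a * 𝔠)))))
    (α β γ : ℂ) (hα : α = d / a) (hβ : β = (2 * a * e - b * d) / (2 * a ^ 2 * 𝔠))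
    (hγ : γ = (b ^ 2 - 4 * a * c) / (4 * a ^ 2 * 𝔠 ^ 2)) :
    ∀ q : ℂ[X], v ((X ^ 2 - C γ) * Dc 1 q + (C α * X + C β) * Sc 1 q) = 0 := by
  intro q
  set ℓ : ℂ[X] := C 𝔠⁻¹ * X + C (b / (2 * a * 𝔠)) with hℓ
  have key : ((X ^ 2 - C γ) * Dc 1 q + (C α * X + C β) * Sc 1 q).comp ℓ =
      (a * 𝔠)⁻¹ • ((C a * X ^ 2 + C b * X + C c) * Dc 𝔠 (q.comp ℓ) +
        (C d * X + C e) * Sc 𝔠 (q.comp ℓ)) := by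
    rw [add_comp, mul_comp, mul_comp, hℓ, Dc_one_comp_affine h𝔠, Sc_one_comp_affine h𝔠, ← hℓ]
    refine Polynomial.funext fun x => ?_
    simp only [hℓ, hα, hβ, hγ, eval_comp, eval_smul, eval_mul, eval_add, eval_sub, eval_pow,
      eval_C, eval_X, smul_eq_mul]
    field_simp
    ring
  rw [hv, key, map_smul, hu, smul_zero]
end

section
/- Let U ⊆ ℂ∖{0} be a set whose closure contains 0, and fix a, b, c, d, e ∈ ℂ with φ(x) = ax² + bx + c, ψ(x) = dx + e, and a·n + d ≠ 0 for every n ∈ ℕ. For each 𝔠 ∈ U let u_𝔠 be a linear functional on ℂ[x] with u_𝔠(1) = 1 satisfying u_𝔠(φ·D_𝔠 p + ψ·S_𝔠 p) = 0 for every polynomial p. Then there exists a unique linear functional u_0 on ℂ[x] such that for every polynomial p, u_𝔠(p) tends to u_0(p) as 𝔠 tends to 0 within U (i.e. along the filter of neighborhoods of 0 restricted to U); in particular, for every n ∈ ℕ the limit of the moments u_𝔠(xⁿ) as 𝔠 → 0 within U exists, is finite, and equals u_0(xⁿ). -/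
open Polynomial

/-- The step-`t` operators applied to `X ^ n`, as a pair `(D X ^ n, S X ^ n)` of polynomials whose
coefficients are polynomials in the step `t`. -/
noncomputable def latticePow : ℕ → ℂ[X][X] × ℂ[X][X]
  | 0 => (0, 1)
  | n + 1 =>
    (X * (latticePow n).1 + (latticePow n).2,
      X * (latticePow n).2 + C (C 4⁻¹ * X ^ 2) * (latticePow n).1)

theorem Dc_X_mul {t : ℂ} (ht : t ≠ 0) (p : ℂ[X]) : Dc t (X * p) = X * Dc t p + Sc t p := by
  have h : (C t⁻¹ : ℂ[X]) * C (t / 2) = C 2⁻¹ := by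
    rw [← C_mul]; congr 1; field_simp
  simp only [Dc, Sc, smul_eq_C_mul, mul_comp, X_comp]
  linear_combination (p.comp (X + C (t / 2)) + p.comp (X - C (t / 2))) * h

theorem Sc_X_mul {t : ℂ} (ht : t ≠ 0) (p : ℂ[X]) :
    Sc t (X * p) = X * Sc t p + C (4⁻¹ * t ^ 2) * Dc t p := by
  have h : (C 2⁻¹ : ℂ[X]) * C (t / 2) = C (4⁻¹ * t ^ 2) * C t⁻¹ := by
    rw [← C_mul, ← C_mul]; congr 1; field_simp; norm_num
  simp only [Dc, Sc, smul_eq_C_mul, mul_comp, X_comp]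
  linear_combination (p.comp (X + C (t / 2)) - p.comp (X - C (t / 2))) * h

theorem map_latticePow {t : ℂ} (ht : t ≠ 0) (n : ℕ) :
    (latticePow n).1.map (evalRingHom t) = Dc t (X ^ n) ∧
      (latticePow n).2.map (evalRingHom t) = Sc t (X ^ n) := by
  induction n with
  | zero =>
    refine ⟨by simp [latticePow, Dc], ?_⟩
    simp only [latticePow, Sc, pow_zero, one_comp, Polynomial.map_one, smul_eq_C_mul]
    rw [show (1 : ℂ[X]) + 1 = C 2 by rw [map_ofNat C 2]; norm_num, ← C_mul]
    norm_num
  | succ n ih =>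
    rw [pow_succ', Dc_X_mul ht, Sc_X_mul ht, ← ih.1, ← ih.2]
    simp [latticePow]

theorem coeff_latticePow (n : ℕ) :
    (∀ k, n ≤ k → (latticePow n).1.coeff k = 0) ∧
      (∀ k, n < k → (latticePow n).2.coeff k = 0) ∧
      (X * (latticePow n).1).coeff n = (n : ℂ[X]) ∧ (latticePow n).2.coeff n = 1 := by
  induction n with
  | zero =>
    refine ⟨by simp [latticePow], fun k hk => ?_, by simp [latticePow], by simp [latticePow]⟩
    simp [latticePow, coeff_one, hk.ne']
  | succ n ih =>
    obtain ⟨h1, h2, h3, h4⟩ := ih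
    refine ⟨fun k hk => ?_, fun k hk => ?_, ?_, ?_⟩
    · obtain ⟨k, rfl⟩ : ∃ j, k = j + 1 := ⟨k - 1, by omega⟩
      simp [latticePow, coeff_X_mul, h1 k (by omega), h2 (k + 1) (by omega)]
    · obtain ⟨k, rfl⟩ : ∃ j, k = j + 1 := ⟨k - 1, by omega⟩
      simp only [latticePow, coeff_add, coeff_X_mul, coeff_C_mul, h2 k (by omega),
        h1 (k + 1) (by omega), mul_zero, add_zero]
    · simp only [latticePow, coeff_add, coeff_X_mul, h3, h4]
      push_cast; rfl
    · simp only [latticePow, coeff_add, coeff_X_mul, coeff_C_mul, h4, h1 (n + 1) (by omega),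
        mul_zero, add_zero]

/-- The polynomial `φ · D X ^ n + ψ · S X ^ n`, with coefficients polynomial in the step. -/
noncomputable def pearsonPow (a b c d e : ℂ) (n : ℕ) : ℂ[X][X] :=
  (C (C a) * X ^ 2 + C (C b) * X + C (C c)) * (latticePow n).1 +
    (C (C d) * X + C (C e)) * (latticePow n).2

theorem pearsonPow_eq (a b c d e : ℂ) (n : ℕ) :
    pearsonPow a b c d e n =
      C (C a) * (X * (X * (latticePow n).1)) + C (C b) * (X * (latticePow n).1) +
        C (C c) * (latticePow n).1 + (C (C d) * (X * (latticePow n).2) +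
        C (C e) * (latticePow n).2) := by
  rw [pearsonPow]; ring

theorem natDegree_pearsonPow_le (a b c d e : ℂ) (n : ℕ) :
    (pearsonPow a b c d e n).natDegree ≤ n + 1 := by
  obtain ⟨h1, h2, -, -⟩ := coeff_latticePow n
  rw [natDegree_le_iff_coeff_eq_zero]
  intro k hk
  obtain ⟨k, rfl⟩ : ∃ j, k = j + 2 := ⟨k - 2, by omega⟩
  simp only [pearsonPow_eq, coeff_add, coeff_C_mul, coeff_X_mul, h1 k (by omega),
    h1 (k + 1) (by omega), h1 (k + 2) (by omega), h2 (k + 1) (by omega), h2 (k + 2) (by omega),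
    mul_zero, add_zero]

theorem coeff_pearsonPow (a b c d e : ℂ) (n : ℕ) :
    (pearsonPow a b c d e n).coeff (n + 1) = C (a * n + d) := by
  obtain ⟨h1, h2, h3, h4⟩ := coeff_latticePow n
  simp only [pearsonPow_eq, coeff_add, coeff_C_mul, coeff_X_mul, h1 n le_rfl,
    h1 (n + 1) (by omega), h2 (n + 1) (by omega), h3, h4]
  simp

/-- The moment recurrence equivalent to the lattice Pearson equation at `X ^ n`. -/
theorem moment_succ {a b c d e t : ℂ} (ht : t ≠ 0) (n : ℕ) (hd : a * (n : ℂ) + d ≠ 0)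
    (v : ℂ[X] →ₗ[ℂ] ℂ)
    (hv : v ((C a * X ^ 2 + C b * X + C c) * Dc t (X ^ n) +
      (C d * X + C e) * Sc t (X ^ n)) = 0) :
    v (X ^ (n + 1)) = -(a * (n : ℂ) + d)⁻¹ *
      ∑ k ∈ Finset.range (n + 1), ((pearsonPow a b c d e n).coeff k).eval t * v (X ^ k) := by
  have hmap : (pearsonPow a b c d e n).map (evalRingHom t) =
      (C a * X ^ 2 + C b * X + C c) * Dc t (X ^ n) + (C d * X + C e) * Sc t (X ^ n) := by
    rw [← (map_latticePow ht n).1, ← (map_latticePow ht n).2]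
    simp [pearsonPow]
  have hdeg : ((pearsonPow a b c d e n).map (evalRingHom t)).natDegree < n + 1 + 1 :=
    Nat.lt_succ_of_le (natDegree_map_le.trans (natDegree_pearsonPow_le a b c d e n))
  rw [← hmap, as_sum_range' _ _ hdeg, map_sum, Finset.sum_range_succ] at hv
  simp only [← smul_X_eq_monomial, map_smul, smul_eq_mul, coeff_map, coe_evalRingHom,
    coeff_pearsonPow, eval_C] at hv
  field_simp
  linear_combination hv

/-- Existence and uniqueness of the weak limit: if `U ⊆ ℂ∖{0}` has `0` in its closure,
`φ(x) = ax² + bx + c`, `ψ(x) = dx + e` with `an + d ≠ 0` for all `n ∈ ℕ`, and for each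
`𝔠 ∈ U` the functional `u_𝔠` is normalised by `u_𝔠(1) = 1` and satisfies the step-`𝔠`
Pearson equation, then there exists a unique linear functional `u₀` such that
`u_𝔠(p) → u₀(p)` for every polynomial `p` as `𝔠 → 0` within `U`. -/
theorem weak_limit_of_lattice_pearson_functionals (U : Set ℂ) (hU0 : (0 : ℂ) ∉ U)
    (hUcl : (0 : ℂ) ∈ closure U) (a b c d e : ℂ)
    (hd : ∀ n : ℕ, a * (n : ℂ) + d ≠ 0)
    (u : ℂ → (ℂ[X] →ₗ[ℂ] ℂ))
    (hnorm : ∀ 𝔠 ∈ U, u 𝔠 1 = 1)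
    (hu : ∀ 𝔠 ∈ U, ∀ p : ℂ[X],
      u 𝔠 ((C a * X ^ 2 + C b * X + C c) * Dc 𝔠 p + (C d * X + C e) * Sc 𝔠 p) = 0) :
    ∃! u₀ : ℂ[X] →ₗ[ℂ] ℂ, ∀ p : ℂ[X],
      Filter.Tendsto (fun 𝔠 => u 𝔠 p) (nhdsWithin 0 U) (nhds (u₀ p)) := by
  have : (nhdsWithin (0 : ℂ) U).NeBot := mem_closure_iff_nhdsWithin_neBot.mp hUcl
  have hU : ∀ t ∈ U, t ≠ 0 := fun t ht h => hU0 (h ▸ ht)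
  have hmom : ∀ n : ℕ, ∃ L : ℂ,
      Filter.Tendsto (fun t => u t (X ^ n)) (nhdsWithin 0 U) (nhds L) := by
    intro n
    induction n using Nat.strong_induction_on with
    | _ n ih =>
      cases n with
      | zero =>
        refine ⟨1, tendsto_const_nhds.congr' ?_⟩
        filter_upwards [self_mem_nhdsWithin] with t ht
        rw [pow_zero, hnorm t ht]
      | succ n =>
        choose! L hL using ih
        refine ⟨_, Filter.Tendsto.congr' ?_ ((tendsto_finsetSum (Finset.range (n + 1))
          fun k hk => ((((pearsonPow a b c d e n).coeff k).continuous.tendsto 0).mono_left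
            nhdsWithin_le_nhds).mul (hL k (Finset.mem_range.mp hk))).const_mul
              (-(a * (n : ℂ) + d)⁻¹))⟩
        filter_upwards [self_mem_nhdsWithin] with t ht
        exact (moment_succ (hU t ht) n (hd n) (u t) (hu t ht _)).symm
  have hlim : ∀ p : ℂ[X], ∃ L : ℂ,
      Filter.Tendsto (fun t => u t p) (nhdsWithin 0 U) (nhds L) := by
    intro p
    induction p using Polynomial.induction_on' with
    | add p q hp hq =>
      obtain ⟨L, hL⟩ := hp
      obtain ⟨M, hM⟩ := hq
      exact ⟨L + M, by simpa using hL.add hM⟩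
    | monomial n r =>
      obtain ⟨L, hL⟩ := hmom n
      exact ⟨r * L, by simpa [← smul_X_eq_monomial] using hL.const_mul r⟩
  choose f hf using hlim
  refine ⟨linearMapOfTendsto f u (tendsto_pi_nhds.mpr hf), hf, fun v hv => ?_⟩
  exact LinearMap.ext fun p => tendsto_nhds_unique (hv p) (hf p)
end

section
/- Let U ⊆ ℂ∖{0} be a set whose closure contains 0, let φ, ψ ∈ ℂ[x] with deg φ ≤ 2 and deg ψ ≤ 1, and for each 𝔠 ∈ U let u_𝔠 be a linear functional on ℂ[x] satisfying u_𝔠(φ·D_𝔠 p + ψ·S_𝔠 p) = 0 for every polynomial p. Suppose u_0 is a linear functional on ℂ[x] such that for every polynomial p, u_𝔠(p) tends to u_0(p) as 𝔠 tends to 0 within U. Then u_0 satisfies the continuous Pearson equation D(φ u_0) = ψ u_0; explicitly, u_0(φ·p′ + ψ·p) = 0 for every polynomial p, where p′ denotes the derivative of p. -/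
open Polynomial

/-- Taylor expansion of a polynomial to first order, with a remainder that is polynomial in the
step. -/
theorem exists_comp_X_add_C_eq (p : ℂ[X]) :
    ∃ K : ℂ[X][X], ∀ h : ℂ,
      p.comp (X + C h) = p + derivative p * C h + K.eval (C h) * C h ^ 2 := by
  obtain ⟨K, hK⟩ := binomExpansion (p.map ((C : ℂ[X] →+* ℂ[X][X]).comp C)) (C X) X
  refine ⟨K, fun h => ?_⟩
  have eval_C (q : ℂ[X]) (y : ℂ[X][X]) :
      ((q.map ((C : ℂ[X] →+* ℂ[X][X]).comp C)).eval y).eval (C h) = q.comp (y.eval (C h)) := by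
    rw [eval_map, ← coe_evalRingHom, hom_eval₂, comp]
    congr 1
    ext
    simp
  have h_eval := congrArg (eval (C h)) hK
  simpa only [derivative_map, eval_add, eval_mul, eval_pow, eval_C, eval_X, Polynomial.eval_C,
    comp_X] using h_eval

/-- The lattice Pearson operator extends polynomially in the step across step `0`, where it is
the continuous Pearson operator. -/
theorem exists_eval_C_eq_Dc_add_Sc (φ ψ p : ℂ[X]) :
    ∃ G : ℂ[X][X], G.coeff 0 = φ * derivative p + ψ * p ∧
      ∀ c : ℂ, c ≠ 0 → φ * Dc c p + ψ * Sc c p = G.eval (C c) := by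
  obtain ⟨K, hK⟩ := exists_comp_X_add_C_eq p
  let half : ℂ[X][X] := C (C 2⁻¹) * X
  refine ⟨C (φ * derivative p + ψ * p)
    + X * (C φ * (K.comp half - K.comp (-half)) * C (C 4⁻¹)
      + X * (C ψ * (K.comp half + K.comp (-half)) * C (C 8⁻¹))), by simp, fun c hc => ?_⟩
  have hhalf : (C 2⁻¹ * C c : ℂ[X]) = C (c / 2) := by
    rw [← C_mul]; congr 1; ring
  have hinv : (C c⁻¹ * C c : ℂ[X]) = 1 := by
    rw [← C_mul, inv_mul_cancel₀ hc, C_1]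
  have h2 : (C 2⁻¹ * 2 : ℂ[X]) = 1 := by
    rw [← C_ofNat, ← C_mul]; norm_num
  have h4 : (C 4⁻¹ : ℂ[X]) = C 2⁻¹ ^ 2 := by
    rw [← C_pow]; norm_num
  have h8 : (C 8⁻¹ : ℂ[X]) = C 2⁻¹ ^ 3 := by
    rw [← C_pow]; norm_num
  have hneg : (X - C (c / 2) : ℂ[X]) = X + C (-(c / 2)) := by
    rw [C_neg, sub_eq_add_neg]
  rw [Dc, Sc, hneg, hK, hK]
  simp only [smul_eq_C_mul, half, eval_add, eval_sub, eval_mul, eval_comp,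
    eval_neg, eval_C, eval_X, hhalf, C_neg, h4, h8]
  generalize K.eval (C (c / 2)) = a
  generalize K.eval (-C (c / 2)) = b
  rw [← hhalf]
  linear_combination (φ * derivative p * (C 2⁻¹ * 2) + φ * (a - b) * C 2⁻¹ ^ 2 * C c) * hinv
    + (φ * derivative p + ψ * p) * h2

/-- A pointwise convergent family of functionals may be evaluated along a polynomial family. -/
theorem tendsto_apply_eval_C {U : Set ℂ} {u : ℂ → (ℂ[X] →ₗ[ℂ] ℂ)} {u₀ : ℂ[X] →ₗ[ℂ] ℂ}
    (hlim : ∀ p : ℂ[X],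
      Filter.Tendsto (fun c => u c p) (nhdsWithin 0 U) (nhds (u₀ p))) (G : ℂ[X][X]) :
    Filter.Tendsto (fun c => u c (G.eval (C c))) (nhdsWithin 0 U) (nhds (u₀ (G.coeff 0))) := by
  have hid : Filter.Tendsto (fun c : ℂ => c) (nhdsWithin 0 U) (nhds 0) :=
    Filter.tendsto_id.mono_left nhdsWithin_le_nhds
  induction G using Polynomial.induction_on' with
  | add p q hp hq => simpa using hp.add hq
  | monomial n a =>
    have h := (hid.pow n).mul (hlim a)
    have hterm (c : ℂ) : u c ((monomial n a).eval (C c)) = c ^ n * u c a := by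
      rw [eval_monomial, ← C_pow, mul_comm, ← smul_eq_C_mul, map_smul, smul_eq_mul]
    simp only [hterm]
    convert h using 2
    rcases eq_or_ne n 0 with rfl | hn
    · simp
    · simp [coeff_monomial, hn]

/-- The weak limit of lattice Pearson functionals satisfies the continuous Pearson
equation: if `0 ∈ closure U`, `U ⊆ ℂ∖{0}`, `deg φ ≤ 2`, `deg ψ ≤ 1`, each `u_𝔠`
(`𝔠 ∈ U`) satisfies `u_𝔠(φ·D_𝔠 p + ψ·S_𝔠 p) = 0`, and `u_𝔠(p) → u₀(p)` as `𝔠 → 0`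
within `U` for every polynomial `p`, then `u₀(φ·p′ + ψ·p) = 0` for every `p`. -/
theorem limit_satisfies_continuous_pearson (U : Set ℂ) (hU0 : (0 : ℂ) ∉ U)
    (hUcl : (0 : ℂ) ∈ closure U) (φ ψ : ℂ[X])
    (hφ : φ.degree ≤ 2) (hψ : ψ.degree ≤ 1)
    (u : ℂ → (ℂ[X] →ₗ[ℂ] ℂ))
    (hu : ∀ 𝔠 ∈ U, ∀ p : ℂ[X], u 𝔠 (φ * Dc 𝔠 p + ψ * Sc 𝔠 p) = 0)
    (u₀ : ℂ[X] →ₗ[ℂ] ℂ)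
    (hlim : ∀ p : ℂ[X],
      Filter.Tendsto (fun 𝔠 => u 𝔠 p) (nhdsWithin 0 U) (nhds (u₀ p))) :
    ∀ p : ℂ[X], u₀ (φ * derivative p + ψ * p) = 0 := by
  intro p
  obtain ⟨G, hG0, hG⟩ := exists_eval_C_eq_Dc_add_Sc φ ψ p
  have : (nhdsWithin (0 : ℂ) U).NeBot := mem_closure_iff_nhdsWithin_neBot.mp hUcl
  have hzero : (fun c => u c (G.eval (C c))) =ᶠ[nhdsWithin 0 U] fun _ => 0 := by
    filter_upwards [self_mem_nhdsWithin] with c hc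
    rw [← hG c (ne_of_mem_of_not_mem hc hU0), hu c hc p]
  rw [← hG0]
  exact tendsto_nhds_unique ((tendsto_apply_eval_C hlim G).congr' hzero) tendsto_const_nhds
end

section
/- (Positive definiteness of the canonical 1-Laguerre functional.) Let α, β ∈ ℝ with α ≠ 0, and for n ≥ 1 define b_n = −(n/(4α²))·((n−1)(α² − 4) + 4β). Then b_n > 0 for every integer n ≥ 1 if and only if α² ≤ 4 and β < 0. -/
/-- Positive definiteness of the canonical 1-Laguerre functional: with
`b_n = −(n/(4α²))·((n−1)(α² − 4) + 4β)` for `n ≥ 1`, one has `b_n > 0` for every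
`n ≥ 1` if and only if `α² ≤ 4` and `β < 0`. -/
theorem one_laguerre_positive_definite_iff (α β : ℝ) (hα : α ≠ 0) (b : ℕ → ℝ)
    (hb : ∀ n : ℕ, b n = -((n : ℝ) / (4 * α ^ 2)) * (((n : ℝ) - 1) * (α ^ 2 - 4) + 4 * β)) :
    (∀ n : ℕ, 1 ≤ n → 0 < b n) ↔ (α ^ 2 ≤ 4 ∧ β < 0) := by
  have key : ∀ m : ℕ, 0 < b (m + 1) ↔ (m : ℝ) * (α ^ 2 - 4) + 4 * β < 0 := by
    intro m
    have hpos : (0 : ℝ) < ((m + 1 : ℕ) : ℝ) / (4 * α ^ 2) := by positivity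
    rw [hb, neg_mul, ← mul_neg, mul_pos_iff_of_pos_left hpos, neg_pos]
    push_cast
    rw [add_sub_cancel_right]
  constructor
  · intro h
    have h' : ∀ m : ℕ, (m : ℝ) * (α ^ 2 - 4) + 4 * β < 0 :=
      fun m => (key m).1 (h (m + 1) (Nat.le_add_left 1 m))
    constructor
    · by_contra! hc
      obtain ⟨m, hm⟩ := Archimedean.arch (-(4 * β)) (sub_pos.2 hc)
      rw [nsmul_eq_mul] at hm
      linarith [h' m]
    · have h₀ := h' 0
      norm_num at h₀
      linarith
  · rintro ⟨h₁, h₂⟩ n hn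
    obtain ⟨m, rfl⟩ := Nat.exists_eq_add_of_le' hn
    rw [key]
    have := mul_nonpos_of_nonneg_of_nonpos (Nat.cast_nonneg (α := ℝ) m) (sub_nonpos.2 h₁)
    linarith
end

section
/- (The canonical 1-Hermite functional is never positive definite.) Let α ∈ ℝ with α ≠ 0, and for n ≥ 1 define b_n = −n·(1/α + (n−1)/4). Then the set {n ∈ ℕ : n ≥ 1 and b_n > 0} is finite; in particular it is not the case that b_n > 0 for all n ≥ 1. -/
/-- The canonical 1-Hermite functional is never positive definite: with
`b_n = −n·(1/α + (n−1)/4)`, the set of `n ≥ 1` with `b_n > 0` is finite; in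
particular it is not the case that `b_n > 0` for all `n ≥ 1`. -/
theorem one_hermite_never_positive_definite (α : ℝ) (hα : α ≠ 0) (b : ℕ → ℝ)
    (hb : ∀ n : ℕ, b n = -(n : ℝ) * (1 / α + ((n : ℝ) - 1) / 4)) :
    {n : ℕ | 1 ≤ n ∧ 0 < b n}.Finite ∧ ¬ (∀ n : ℕ, 1 ≤ n → 0 < b n) := by
  have hfin : {n : ℕ | 1 ≤ n ∧ 0 < b n}.Finite := by
    refine (Set.finite_Iic ⌈1 - 4 * (1 / α)⌉₊).subset ?_
    rintro n ⟨-, hpos⟩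
    rw [hb] at hpos
    have hneg : 1 / α + ((n : ℝ) - 1) / 4 < 0 := by
      by_contra! h
      nlinarith [mul_nonneg n.cast_nonneg h]
    have hle : (n : ℝ) ≤ ⌈1 - 4 * (1 / α)⌉₊ :=
      le_trans (by linarith) (Nat.le_ceil _)
    exact_mod_cast hle
  refine ⟨hfin, fun h => Set.Ici_infinite 1 (hfin.subset fun n hn => ?_)⟩
  exact ⟨hn, h n hn⟩
end

section
/- (The canonical 1-Jacobi and 1-Bessel functionals are never positive definite.) Let α, β, γ ∈ ℝ. Then there exists N ∈ ℕ such that for every integer n ≥ N one has (2n−3+α) > 0, (2n−1+α) > 0, (2n−2+α) > 0, and b_n < 0, where b_n = −(n(n−2+α)/((2n−3+α)(2n−1+α)))·((n−1)(n−1+α)/4 + β²/(2n−2+α)² − γ). In particular it is not the case that b_n > 0 for all sufficiently large n, so the associated functional cannot be positive definite (the case γ = 0 being the 1-Bessel family). -/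
/-- The canonical 1-Jacobi (and, for `γ = 0`, 1-Bessel) functionals are never
positive definite: with
`b_n = −(n(n−2+α)/((2n−3+α)(2n−1+α)))·((n−1)(n−1+α)/4 + β²/(2n−2+α)² − γ)`,
there exists `N` such that for all `n ≥ N` one has `2n−3+α > 0`, `2n−1+α > 0`,
`2n−2+α > 0` and `b_n < 0`; in particular it is not the case that `b_n > 0` for all
sufficiently large `n`. -/
theorem one_jacobi_never_positive_definite (α β γ : ℝ) (b : ℕ → ℝ)
    (hb : ∀ n : ℕ, b n =
      -(((n : ℝ) * ((n : ℝ) - 2 + α)) / ((2 * (n : ℝ) - 3 + α) * (2 * (n : ℝ) - 1 + α))) *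
        (((n : ℝ) - 1) * ((n : ℝ) - 1 + α) / 4 + β ^ 2 / (2 * (n : ℝ) - 2 + α) ^ 2 - γ)) :
    (∃ N : ℕ, ∀ n : ℕ, N ≤ n →
      0 < 2 * (n : ℝ) - 3 + α ∧ 0 < 2 * (n : ℝ) - 1 + α ∧
      0 < 2 * (n : ℝ) - 2 + α ∧ b n < 0) ∧
    ¬ (∃ M : ℕ, ∀ n : ℕ, M ≤ n → 0 < b n) := by
  have eventually_neg : ∃ N : ℕ, ∀ n : ℕ, N ≤ n →
      0 < 2 * (n : ℝ) - 3 + α ∧ 0 < 2 * (n : ℝ) - 1 + α ∧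
      0 < 2 * (n : ℝ) - 2 + α ∧ b n < 0 := by
    obtain ⟨N, hN⟩ := exists_nat_ge (|α| + |γ| + 5)
    refine ⟨N, fun n hn => ?_⟩
    have hNn : (N : ℝ) ≤ n := by exact_mod_cast hn
    have hα := neg_abs_le α
    have hα₀ := abs_nonneg α
    have hγ := le_abs_self γ
    have hγ₀ := abs_nonneg γ
    have h₁ : 0 < 2 * (n : ℝ) - 3 + α := by linarith
    have h₂ : 0 < 2 * (n : ℝ) - 1 + α := by linarith
    refine ⟨h₁, h₂, by linarith, ?_⟩
    have hn₀ : (0 : ℝ) < n := by linarith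
    have h₃ : 0 < (n : ℝ) - 2 + α := by linarith
    have hprod : 4 * (4 + |γ|) ≤ ((n : ℝ) - 1) * ((n : ℝ) - 1 + α) :=
      mul_le_mul (by linarith) (by linarith) (by linarith) (by linarith)
    have hβ : 0 ≤ β ^ 2 / (2 * (n : ℝ) - 2 + α) ^ 2 := by positivity
    rw [hb n]
    exact mul_neg_of_neg_of_pos
      (neg_neg_of_pos (div_pos (mul_pos hn₀ h₃) (mul_pos h₁ h₂))) (by linarith)
  refine ⟨eventually_neg, ?_⟩
  rintro ⟨M, hM⟩
  obtain ⟨N, hN⟩ := eventually_neg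
  exact lt_asymm (hM _ (le_max_left M N)) (hN _ (le_max_right M N)).2.2.2
end
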